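/- For a = 1 and any b ≥ 1, the edge count satisfies e(n) = b·∑_{k=1}^{n-1} s(k-1)·s(n-k-1) for all n ≥ 1. -/

import Mathlib

/-- The self-convolution of a sequence with `s 0 = s 1 = 1` and
`s (n + 2) = s (n + 1) + b * s n` satisfies the same recurrence with forcing term `s (n + 1)`. -/
lemma sum_range_mul_sub_add_two {R : Type*} [CommRing R] {b : R} {s : ℕ → R}
    (hs0 : s 0 = 1) (hs1 : s 1 = 1) (hs : ∀ n, s (n + 2) = s (n + 1) + b * s n) (m : ℕ) :
    ∑ i ∈ Finset.range (m + 2), s i * s (m + 1 - i) =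
      ∑ i ∈ Finset.range (m + 1), s i * s (m - i) +
        b * ∑ i ∈ Finset.range m, s i * s (m - 1 - i) + s (m + 1) := by
  have key : ∑ i ∈ Finset.range m, s i * s (m + 1 - i) =
      ∑ i ∈ Finset.range m, s i * s (m - i) +
        b * ∑ i ∈ Finset.range m, s i * s (m - 1 - i) := by
    rw [Finset.mul_sum, ← Finset.sum_add_distrib]
    refine Finset.sum_congr rfl fun i hi => ?_
    obtain ⟨j, rfl⟩ := Nat.exists_eq_add_of_lt (Finset.mem_range.mp hi)
    rw [show i + j + 1 + 1 - i = j + 2 by omega, show i + j + 1 - i = j + 1 by omega,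
      show i + j + 1 - 1 - i = j by omega, hs]
    ring
  rw [Finset.sum_range_succ, Finset.sum_range_succ, key, Finset.sum_range_succ _ m,
    Nat.add_sub_cancel_left, Nat.sub_self, Nat.sub_self, hs0, hs1]
  ring

theorem horadam_edge_count_a_eq_one (b : ℕ) (hb : 0 < b)
    (s e : ℕ → ℤ) (hs0 : s 0 = 1) (hs1 : s 1 = 1)
    (hsrec : ∀ n, 2 ≤ n → s n = s (n - 1) + (b : ℤ) * s (n - 2))
    (he0 : e 0 = 0) (he1 : e 1 = 0)
    (herec : ∀ n, 2 ≤ n →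
      e n = e (n - 1) + (b : ℤ) * e (n - 2) + s n - s (n - 1)) :
    ∀ n, 1 ≤ n →
      e n = (b : ℤ) * ∑ k ∈ Finset.Ico 1 n, s (k - 1) * s (n - k - 1) := by
  have hs (n : ℕ) : s (n + 2) = s (n + 1) + (b : ℤ) * s n := hsrec (n + 2) (by omega)
  have he (n : ℕ) : e (n + 2) = e (n + 1) + (b : ℤ) * e n + s (n + 2) - s (n + 1) :=
    herec (n + 2) (by omega)
  have main (m : ℕ) : e (m + 1) = (b : ℤ) * ∑ i ∈ Finset.range m, s i * s (m - 1 - i) := by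
    induction m using Nat.twoStepInduction with
    | zero => simp [he1]
    | one => simp [he 0, hs 0, he0, he1, hs0, hs1]
    | more m ih₀ ih₁ =>
      have h := sum_range_mul_sub_add_two hs0 hs1 hs m
      simp only [Nat.add_sub_cancel] at ih₁
      rw [show m + 2 - 1 = m + 1 by omega, h, he (m + 1), ih₁, ih₀, hs (m + 1)]
      ring
  intro n hn
  obtain ⟨m, rfl⟩ := Nat.exists_eq_add_of_le' hn
  rw [main, Finset.sum_Ico_eq_sum_range, Nat.add_sub_cancel]
  congr 1
  refine Finset.sum_congr rfl fun i _ => ?_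
  rw [Nat.add_sub_cancel_left, show m + 1 - (1 + i) - 1 = m - 1 - i by omega]
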